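/- arXiv:1909.12139 — 6 statements merged into one kernel-verified Lean document; each statement's English description precedes it below -/
import Mathlib

section
/- For every natural number n ≥ 9 and every natural number k ≥ 1, the k-fold iterated prime p_n^(k) satisfies p_n^(k) < 2^(2k-1) · n · (k-1)! · (log(max{k,n}))^k. -/
open Real

/-- `nthPrime n` is the `n`-th prime number, 1-indexed: `nthPrime 1 = 2`, `nthPrime 2 = 3`, … -/
noncomputable def nthPrime (n : ℕ) : ℕ := Nat.nth Nat.Prime (n - 1)

/-- `iterPrime n k` is the `k`-fold iterated prime `p_n^(k)`:
`iterPrime n 0 = n`, `iterPrime n 1 = p_n`, and `iterPrime n (k+1) = p_{iterPrime n k}`. -/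
noncomputable def iterPrime (n : ℕ) : ℕ → ℕ
  | 0 => n
  | k + 1 => nthPrime (iterPrime n k)

namespace Nat

/-- A number below `(N + 1) ^ 2` that is coprime to all primes up to `N` is prime. -/
theorem prime_of_coprime_primorial {m N : ℕ} (hm : 2 ≤ m) (hN : m < (N + 1) ^ 2)
    (h : m.Coprime (primorial N)) : m.Prime := by
  by_contra hp
  have hq : m.minFac.Prime := Nat.minFac_prime (by lia)
  have hle : m.minFac ≤ N := by
    have := Nat.minFac_sq_le_self (by lia) hp
    nlinarith
  have hdvd : m.minFac ∣ primorial N := hq.dvd_primorial_iff.2 hle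
  exact hq.one_lt.ne' (Nat.eq_one_of_dvd_coprimes h (Nat.minFac_dvd m) hdvd)

theorem primorial_hundred : primorial 100 = 2305567963945518424753102147331756070 := by
  decide +kernel

/-- A lower bound for the number of primes below `128 + b` obtained by sieving with the
primes up to `100`. -/
theorem le_count_prime_of_sieve {b c : ℕ} (hb : 128 + b ≤ 101 ^ 2)
    (h : c ≤ Nat.count
      (fun k ↦ (128 + k).gcd 2305567963945518424753102147331756070 = 1) b) :
    31 + c ≤ Nat.count Nat.Prime (128 + b) := by
  have h31 : Nat.count Nat.Prime 128 = 31 := by decide +kernel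
  rw [Nat.count_add, h31]
  gcongr
  refine h.trans ?_
  rw [Nat.count_eq_card_filter_range, Nat.count_eq_card_filter_range]
  refine Finset.card_le_card fun k hk ↦ ?_
  rw [Finset.mem_filter, Finset.mem_range] at hk ⊢
  refine ⟨hk.1, prime_of_coprime_primorial (N := 100) (by lia) (by lia) ?_⟩
  rw [primorial_hundred]
  exact hk.2

end Nat

theorem nthPrime_lt_of_le_count {n q : ℕ} (hn : 1 ≤ n) (h : n ≤ Nat.count Nat.Prime q) :
    nthPrime n < q :=
  Nat.nth_lt_of_lt_count (by lia)

theorem lt_nthPrime {n : ℕ} (hn : 1 ≤ n) : n < nthPrime n := by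
  have := Nat.add_two_le_nth_prime (n - 1)
  rw [nthPrime]
  lia

theorem primeCounting_nthPrime {n : ℕ} (hn : 1 ≤ n) : Nat.primeCounting (nthPrime n) = n := by
  rw [Nat.primeCounting_eq_primeCounting'_succ, Nat.primeCounting', nthPrime,
    Nat.count_nth_succ_of_infinite Nat.infinite_setOfPred_prime]
  lia

/-- If there are at least `c` primes below `q`, and `q ≤ 2 a log a` is witnessed by
`2 ^ u ≤ a ^ v`, then `p_n < 2 n log n` for all `a ≤ n ≤ c`. -/
theorem nthPrime_lt_of_mem_Icc {a c q u v n : ℕ} (ha : 1 ≤ a) (hv : 0 < v)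
    (hc : c ≤ Nat.count Nat.Prime q) (huv : 2 ^ u ≤ a ^ v)
    (hq : (q : ℝ) * v ≤ 2 * a * (u * 0.6931471803)) (han : a ≤ n) (hnc : n ≤ c) :
    (nthPrime n : ℝ) < 2 * n * Real.log n := by
  have hp : (nthPrime n : ℝ) < q := mod_cast nthPrime_lt_of_le_count (ha.trans han) (hnc.trans hc)
  have hlog : u * Real.log 2 ≤ v * Real.log a := by
    rw [← Real.log_pow, ← Real.log_pow]
    exact Real.log_le_log (by positivity) (mod_cast huv)
  have ha' : (1 : ℝ) ≤ a := mod_cast ha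
  have han' : (a : ℝ) ≤ n := mod_cast han
  have hv' : (0 : ℝ) < v := mod_cast hv
  have h2 : (u : ℝ) * 0.6931471803 ≤ v * Real.log a := by
    refine le_trans ?_ hlog
    gcongr
    exact Real.log_two_gt_d9.le
  have h3 : (q : ℝ) ≤ 2 * a * Real.log a := by
    refine le_of_mul_le_mul_right ?_ hv'
    calc (q : ℝ) * v ≤ 2 * a * (u * 0.6931471803) := hq
      _ ≤ 2 * a * (v * Real.log a) := by gcongr
      _ = 2 * a * Real.log a * v := by ring
  have h4 : 2 * a * Real.log a ≤ 2 * n * Real.log n := by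
    have := Real.log_nonneg ha'
    gcongr
  linarith

theorem nthPrime_lt_of_le_thousand {n : ℕ} (hn : 9 ≤ n) (hn' : n ≤ 1000) :
    (nthPrime n : ℝ) < 2 * n * Real.log n := by
  rcases le_or_gt n 12 with h | h
  · exact nthPrime_lt_of_mem_Icc (a := 9) (q := 39) (u := 19) (v := 6) (by norm_num) (by norm_num)
      (by decide +kernel) (by norm_num) (by norm_num) hn h
  rcases le_or_gt n 18 with h' | h'
  · exact nthPrime_lt_of_mem_Icc (a := 13) (q := 66) (u := 11) (v := 3) (by norm_num) (by norm_num)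
      (by decide +kernel) (by norm_num) (by norm_num) h h'
  clear h
  rcases le_or_gt n 29 with h | h
  · exact nthPrime_lt_of_mem_Icc (a := 19) (q := 111) (u := 38) (v := 9) (by norm_num)
      (by norm_num) (by decide +kernel) (by norm_num) (by norm_num) h' h
  clear h'
  rcases le_or_gt n 46 with h' | h'
  · exact nthPrime_lt_of_mem_Icc (a := 30) (q := 204) (u := 157) (v := 32) (by norm_num)
      (by norm_num) (Nat.le_count_prime_of_sieve (b := 76) (c := 15) (by norm_num)
        (by decide +kernel)) (by norm_num) (by norm_num) h h'
  clear h
  rcases le_or_gt n 66 with h | h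
  · exact nthPrime_lt_of_mem_Icc (a := 47) (q := 320) (u := 5) (v := 1) (by norm_num)
      (by norm_num) (Nat.le_count_prime_of_sieve (b := 192) (c := 35) (by norm_num)
        (by decide +kernel)) (by norm_num) (by norm_num) h' h
  clear h'
  rcases le_or_gt n 97 with h' | h'
  · exact nthPrime_lt_of_mem_Icc (a := 67) (q := 512) (u := 6) (v := 1) (by norm_num)
      (by norm_num) (Nat.le_count_prime_of_sieve (b := 384) (c := 66) (by norm_num)
        (by decide +kernel)) (by norm_num) (by norm_num) h h'
  clear h
  rcases le_or_gt n 154 with h | h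
  · exact nthPrime_lt_of_mem_Icc (a := 98) (q := 896) (u := 33) (v := 5) (by norm_num)
      (by norm_num) (Nat.le_count_prime_of_sieve (b := 768) (c := 123) (by norm_num)
        (by decide +kernel)) (by norm_num) (by norm_num) h' h
  clear h'
  rcases le_or_gt n 242 with h' | h'
  · exact nthPrime_lt_of_mem_Icc (a := 155) (q := 1536) (u := 29) (v := 4) (by norm_num)
      (by norm_num) (Nat.le_count_prime_of_sieve (b := 1408) (c := 211) (by norm_num)
        (by decide +kernel)) (by norm_num) (by norm_num) h h'
  clear h
  rcases le_or_gt n 381 with h | h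
  · exact nthPrime_lt_of_mem_Icc (a := 243) (q := 2624) (u := 39) (v := 5) (by norm_num)
      (by norm_num) (Nat.le_count_prime_of_sieve (b := 2496) (c := 350) (by norm_num)
        (by decide +kernel)) (by norm_num) (by norm_num) h' h
  clear h'
  rcases le_or_gt n 607 with h' | h'
  · exact nthPrime_lt_of_mem_Icc (a := 382) (q := 4480) (u := 17) (v := 2) (by norm_num)
      (by norm_num) (Nat.le_count_prime_of_sieve (b := 4352) (c := 576) (by norm_num)
        (by decide +kernel)) (by norm_num) (by norm_num) h h'
  clear h
  rcases le_or_gt n 982 with h | h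
  · exact nthPrime_lt_of_mem_Icc (a := 608) (q := 7744) (u := 46) (v := 5) (by norm_num)
      (by norm_num) (Nat.le_count_prime_of_sieve (b := 7616) (c := 951) (by norm_num)
        (by decide +kernel)) (by norm_num) (by norm_num) h' h
  · exact nthPrime_lt_of_mem_Icc (a := 983) (q := 8192) (u := 9) (v := 1) (by norm_num)
      (by norm_num) (Nat.le_count_prime_of_sieve (b := 8064) (c := 997) (by norm_num)
        (by decide +kernel)) (by norm_num) (by norm_num) h (by lia : n ≤ 31 + 997)

theorem nthPrime_lt_of_thousand_le {n : ℕ} (hn : 1000 ≤ n) :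
    (nthPrime n : ℝ) < 2 * n * Real.log n := by
  have hn' : (1000 : ℝ) ≤ n := mod_cast hn
  have hpn : (n : ℝ) < nthPrime n := mod_cast lt_nthPrime (by lia : 1 ≤ n)
  set p : ℝ := (nthPrime n : ℝ)
  set t := Real.log n
  have hp0 : 0 < p := by linarith
  have hcheb : p * Real.log 2 - Real.log (p + 1) ≤ n * Real.log p := by
    have h := (Chebyshev.psi_ge (nthPrime n)).trans
      (Chebyshev.psi_le_primeCounting_mul_log (nthPrime n))
    rwa [primeCounting_nthPrime (by lia)] at h
  have hlogp1 : Real.log (p + 1) ≤ Real.log p + 1 / 1000 := by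
    have h := Real.log_le_sub_one_of_pos (x := (p + 1) / p) (by positivity)
    rw [Real.log_div (by positivity) (by positivity)] at h
    have : (p + 1) / p - 1 = 1 / p := by field_simp; ring
    have : 1 / p ≤ 1 / 1000 := by gcongr; linarith
    linarith
  have ht_lb : 6.9 ≤ t := by
    have h1 : Real.exp 69 ≤ (n : ℝ) ^ 10 := by
      calc Real.exp 69 = Real.exp 1 ^ 69 := by rw [← Real.exp_nat_mul]; norm_num
        _ ≤ 2.7182818286 ^ 69 := by
          gcongr
          exact Real.exp_one_lt_d9.le
        _ ≤ 1000 ^ 10 := by norm_num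
        _ ≤ (n : ℝ) ^ 10 := by gcongr
    have h2 := Real.log_le_log (Real.exp_pos _) h1
    rw [Real.log_exp, Real.log_pow] at h2
    push_cast at h2
    linarith
  by_contra! hle
  have hX : (0 : ℝ) < 2 * n * t := by positivity
  have hlogX : Real.log (2 * n * t) = Real.log 2 + t + Real.log t := by
    rw [Real.log_mul (by positivity) (by positivity), Real.log_mul (by positivity) (by positivity)]
  have hlogt : Real.log t ≤ 3 * Real.log 2 + t / 8 - 1 := by
    have h := Real.log_le_sub_one_of_pos (x := t / 8) (by positivity)
    rw [Real.log_div (by positivity) (by positivity),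
      show (8 : ℝ) = 2 ^ 3 by norm_num, Real.log_pow] at h
    push_cast at h
    linarith
  have hlogp : Real.log p ≤ Real.log (2 * n * t) + (p / (2 * n * t) - 1) := by
    have h := Real.log_le_sub_one_of_pos (x := p / (2 * n * t)) (by positivity)
    rw [Real.log_div (by positivity) (by positivity)] at h
    linarith
  obtain ⟨s, hs, hs1⟩ : ∃ s, p = s * (2 * n * t) ∧ 1 ≤ s :=
    ⟨p / (2 * n * t), by field_simp, by rwa [one_le_div hX]⟩
  have hdiv : p / (2 * n * t) = s := by rw [hs]; field_simp
  rw [hdiv, hlogX] at hlogp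
  have hl1 := Real.log_two_gt_d9
  have hl2 := Real.log_two_lt_d9
  have hn1 : (n + 1 : ℝ) ≤ 1.001 * n := by linarith
  have hbound : s * (2 * n * t) * 0.6931 ≤ 1.001 * n * (1.125 * t + 0.773 + s) + 1 / 1000 := by
    have hmul : (n + 1) * Real.log p ≤ 1.001 * n * (1.125 * t + 0.773 + s) := by
      gcongr
      linarith
    have hmul' : p * 0.6931 ≤ p * Real.log 2 := by
      have : (0.6931 : ℝ) ≤ Real.log 2 := by linarith
      gcongr
    rw [← hs]
    linarith
  have hgap : 1.001 * (1.125 * t + 0.773 + s) + 1 / 1000 ≤ 1.3862 * (s * t) := by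
    nlinarith [mul_nonneg (sub_nonneg.2 hs1) (sub_nonneg.2 ht_lb)]
  have hgap' := mul_le_mul_of_nonneg_left hgap (by positivity : (0 : ℝ) ≤ n)
  nlinarith

theorem nthPrime_lt {n : ℕ} (hn : 9 ≤ n) : (nthPrime n : ℝ) < 2 * n * Real.log n := by
  rcases le_total n 1000 with h | h
  · exact nthPrime_lt_of_le_thousand hn h
  · exact nthPrime_lt_of_thousand_le h

theorem le_iterPrime {n : ℕ} (hn : 1 ≤ n) (k : ℕ) : n ≤ iterPrime n k := by
  induction k with
  | zero => exact le_rfl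
  | succ k ih => exact ih.trans (lt_nthPrime (hn.trans ih)).le

theorem Real.four_mul_log_le {x : ℝ} (hx : 9 ≤ x) : 4 * Real.log x ≤ x := by
  have h9 : Real.log 9 ≤ 2.25 := by
    have h : Real.log ((9 : ℝ) ^ 5) ≤ Real.log (2 ^ 16) := by
      gcongr
      norm_num
    rw [Real.log_pow, Real.log_pow] at h
    push_cast at h
    linarith [Real.log_two_lt_d9]
  have h := Real.log_le_sub_one_of_pos (x := x / 9) (by positivity)
  rw [Real.log_div (by positivity) (by positivity)] at h
  linarith

theorem log_factorial_le (k : ℕ) : Real.log (k.factorial) ≤ k * Real.log (k + 1) := by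
  rw [← Real.log_pow]
  refine Real.log_le_log (by positivity) ?_
  exact_mod_cast (Nat.factorial_le_pow k).trans (Nat.pow_le_pow_left k.le_succ k)

theorem iterPrime_upper_bound (n k : ℕ) (hn : 9 ≤ n) (hk : 1 ≤ k) :
    (iterPrime n k : ℝ) <
      2 ^ (2 * k - 1) * n * (Nat.factorial (k - 1)) * (Real.log (max k n)) ^ k := by
  obtain ⟨k, rfl⟩ := Nat.exists_eq_add_of_le' hk
  clear hk
  induction k with
  | zero =>
    have h := nthPrime_lt hn
    simpa [iterPrime, max_eq_right (by norm_cast; lia : (1 : ℝ) ≤ n)] using h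
  | succ k ih =>
    simp only [Nat.add_sub_cancel] at ih ⊢
    set m := iterPrime n (k + 1)
    have hnm : n ≤ m := le_iterPrime (by lia) _
    have hm0 : (0 : ℝ) < m := by norm_cast; lia
    have hn9 : (9 : ℝ) ≤ n := mod_cast hn
    set M : ℝ := max ((k + 1 : ℕ) : ℝ) n with hM
    have hnM : (n : ℝ) ≤ M := le_max_right _ _
    have hkM : (k : ℝ) + 1 ≤ M := by
      rw [hM]; push_cast; exact le_max_left _ _
    have hMM' : M ≤ max ((k + 1 + 1 : ℕ) : ℝ) n := by
      refine max_le_max ?_ le_rfl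
      push_cast; linarith
    set M' : ℝ := max ((k + 1 + 1 : ℕ) : ℝ) n
    have hLL' : Real.log M ≤ Real.log M' := Real.log_le_log (by linarith) hMM'
    have hL : 0 < Real.log M := Real.log_pos (by linarith)
    have hloglog : 2 * Real.log 2 + Real.log (Real.log M) ≤ Real.log M := by
      have h4 : Real.log (4 * Real.log M) ≤ Real.log M :=
        Real.log_le_log (by positivity) (Real.four_mul_log_le (by linarith))
      rwa [Real.log_mul (by norm_num) hL.ne', show (4 : ℝ) = 2 ^ 2 by norm_num, Real.log_pow] at h4
    have hlogm : Real.log m ≤ 2 * (k + 1) * Real.log M := by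
      have h := Real.log_le_log hm0 ih.le
      rw [Real.log_mul (by positivity) (by positivity), Real.log_mul (by positivity) (by positivity),
        Real.log_mul (by positivity) (by positivity), Real.log_pow, Real.log_pow,
        show 2 * (k + 1) - 1 = 2 * k + 1 by lia] at h
      have hfac : Real.log k.factorial ≤ k * Real.log M := by
        refine (log_factorial_le k).trans ?_
        gcongr
      have hlogn : Real.log n ≤ Real.log M := Real.log_le_log (by linarith) hnM
      have hk := mul_le_mul_of_nonneg_left hloglog (by positivity : (0 : ℝ) ≤ k + 1)
      have hl2 := Real.log_pos one_lt_two
      push_cast at h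
      linarith
    calc (iterPrime n (k + 1 + 1) : ℝ) = nthPrime m := rfl
      _ < 2 * m * Real.log m := nthPrime_lt (hn.trans hnm)
      _ ≤ 2 * m * (2 * (k + 1) * Real.log M) := by gcongr
      _ ≤ 2 * (2 ^ (2 * (k + 1) - 1) * n * k.factorial * Real.log M ^ (k + 1)) *
          (2 * (k + 1) * Real.log M) := by gcongr
      _ = 2 ^ (2 * (k + 1 + 1) - 1) * n * (k + 1).factorial * Real.log M ^ (k + 1 + 1) := by
        rw [show 2 * (k + 1) - 1 = 2 * k + 1 by lia,
          show 2 * (k + 1 + 1) - 1 = 2 * k + 1 + 2 by lia, Nat.factorial_succ]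
        push_cast
        ring
      _ ≤ 2 ^ (2 * (k + 1 + 1) - 1) * n * (k + 1).factorial * Real.log M' ^ (k + 1 + 1) := by
        gcongr
end

section
/- For all natural numbers n and k with 9 ≤ n ≤ k, the k-fold iterated prime satisfies p_n^(k) < (4 · k · log k)^k. -/
open Real Filter

theorem log_ge_of_nine_le {x : ℝ} (hx : 9 ≤ x) : 2.19 ≤ Real.log x := by
  have h8 : Real.log 8 = 3 * Real.log 2 := by
    rw [show (8 : ℝ) = 2 ^ 3 by norm_num, Real.log_pow]; norm_num
  have h9 : Real.log 9 = Real.log 8 + Real.log (9 / 8) := by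
    rw [← Real.log_mul (by norm_num) (by norm_num)]; norm_num
  have h := Real.one_sub_inv_le_log_of_pos (show (0 : ℝ) < 9 / 8 by norm_num)
  have h2 := Real.log_two_gt_d9
  have hm := Real.log_le_log (by norm_num) hx
  norm_num at h h2 ⊢
  linarith

/-- The graph of `log` lies below its tangent at `y`. -/
theorem log_le_log_add_div_sub_one {x y : ℝ} (hx : 0 < x) (hy : 0 < y) :
    Real.log x ≤ Real.log y + x / y - 1 := by
  have h := Real.log_le_sub_one_of_pos (div_pos hx hy)
  rw [Real.log_div hx.ne' hy.ne'] at h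
  linarith

theorem le_nthPrime (m : ℕ) : m ≤ nthPrime m := by
  have := Nat.add_two_le_nth_prime (m - 1)
  unfold nthPrime
  omega

theorem primeCounting_nthPrime_s1 {m : ℕ} (hm : m ≠ 0) : Nat.primeCounting (nthPrime m) = m := by
  unfold nthPrime Nat.primeCounting Nat.primeCounting'
  rw [Nat.count_nth_succ_of_infinite Nat.infinite_setOfPred_prime]
  omega

theorem nthPrime_le_three_mul_mul_log {m : ℕ} (hm : 9 ≤ m) :
    (nthPrime m : ℝ) ≤ 3 * m * Real.log m := by
  have hmR : (9 : ℝ) ≤ m := by exact_mod_cast hm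
  have ht := log_ge_of_nine_le hmR
  have hpm : (m : ℝ) ≤ nthPrime m := by exact_mod_cast le_nthPrime m
  have hpi := Chebyshev.pi_ge (nthPrime m)
  rw [primeCounting_nthPrime_s1 (by omega)] at hpi
  set p := (nthPrime m : ℝ)
  set t := Real.log (m : ℝ) with htdef
  by_contra! hlt
  set y : ℝ := 3 * m * t with hy
  have hp0 : 0 < p := by linarith
  have hy59 : 59 ≤ y := by nlinarith
  rw [div_le_iff₀ (Real.log_pos (by linarith))] at hpi
  have hlog_succ : Real.log (p + 1) ≤ Real.log p + 0.017 := by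
    have h := log_le_log_add_div_sub_one (x := p + 1) (by linarith) hp0
    have h' : (p + 1) / p ≤ 1.017 := by
      rw [div_le_iff₀ hp0]; linarith
    linarith
  have hlogp := log_le_log_add_div_sub_one hp0 (show 0 < y by linarith)
  have hlogy : Real.log y = t + Real.log (3 * t) := by
    rw [hy, htdef, ← Real.log_mul (by linarith) (by linarith)]
    congr 1; ring
  have h3t := log_le_log_add_div_sub_one (x := 3 * t) (y := 8) (by linarith) (by norm_num)
  have h8 : Real.log 8 = 3 * Real.log 2 := by
    rw [show (8 : ℝ) = 2 ^ 3 by norm_num, Real.log_pow]; norm_num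
  have h2 := Real.log_two_gt_d9
  have h2' := Real.log_two_lt_d9
  have hq : 1 < p / y := by rw [lt_div_iff₀ (by linarith)]; linarith
  have hpy : p = p / y * y := by field_simp
  set q := p / y
  have hly : Real.log y ≤ 1.375 * t + 1.0795 := by norm_num at h2'; linarith
  -- the main inequality at `y`
  have key : (m + 1) * (1.375 * t + 1.0795) + 0.017 < y * Real.log 2 := by
    have h6 : y * 0.6931471803 ≤ y * Real.log 2 := by gcongr
    have h7 : 9 * (0.7044 * t - 1.0795) ≤ m * (0.7044 * t - 1.0795) := by
      apply mul_le_mul_of_nonneg_right hmR; linarith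
    have h8 : 0 ≤ (m : ℝ) * t := by positivity
    rw [hy] at h6 ⊢
    linarith
  have hb : p * Real.log 2 ≤ (m + 1) * (1.375 * t + 1.0795 + q - 1) + 0.017 := by
    have : (m + 1) * Real.log p ≤ (m + 1) * (1.375 * t + 1.0795 + q - 1) := by
      gcongr; linarith
    linarith
  have hslope : (m : ℝ) + 1 ≤ y * Real.log 2 := by nlinarith
  have := mul_nonneg (sub_nonneg.2 hq.le) (sub_nonneg.2 hslope)
  rw [hpy] at hb
  linarith

theorem three_mul_log_mul_le {k : ℝ} (hk : 9 ≤ k) :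
    3 * Real.log (k * (27 / 4 * Real.log k)) ≤ 27 / 4 * Real.log k := by
  have ht := log_ge_of_nine_le hk
  rw [Real.log_mul (by linarith) (by linarith)]
  have h := log_le_log_add_div_sub_one (x := 27 / 4 * Real.log k) (y := 16)
    (by linarith) (by norm_num)
  have h16 : Real.log 16 = 4 * Real.log 2 := by
    rw [show (16 : ℝ) = 2 ^ 4 by norm_num, Real.log_pow]; norm_num
  have h2 := Real.log_two_lt_d9
  norm_num at h2
  linarith

theorem iterPrime_le_mul_factorial_mul_pow {n k : ℕ} (hn : 9 ≤ n) (hnk : n ≤ k) {j : ℕ}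
    (hj : j ≤ k) :
    9 ≤ iterPrime n j ∧
      (iterPrime n j : ℝ) ≤ k * j.factorial * (27 / 4 * Real.log k) ^ j := by
  have hk : (9 : ℝ) ≤ k := by exact_mod_cast hn.trans hnk
  have ht := log_ge_of_nine_le hk
  have hD := three_mul_log_mul_le hk
  set D := 27 / 4 * Real.log (k : ℝ)
  have hD0 : 0 < D := by positivity
  induction j with
  | zero => simpa [iterPrime] using ⟨hn, hnk⟩
  | succ j ih =>
    obtain ⟨h9, hle⟩ := ih (by omega)
    refine ⟨h9.trans (le_nthPrime _), (nthPrime_le_three_mul_mul_log h9).trans ?_⟩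
    have hx : (9 : ℝ) ≤ iterPrime n j := by exact_mod_cast h9
    set x := (iterPrime n j : ℝ)
    have hfac : (j.factorial : ℝ) ≤ (k : ℝ) ^ j := by
      exact_mod_cast (Nat.factorial_le_pow j).trans (Nat.pow_le_pow_left (by omega) j)
    have hlog : Real.log x ≤ Real.log k + j * Real.log (k * D) := by
      rw [← Real.log_pow, ← Real.log_mul (by positivity) (by positivity), mul_pow, ← mul_assoc]
      apply Real.log_le_log (by linarith)
      exact hle.trans (by gcongr)
    have hfactor : 3 * Real.log x ≤ (j + 1) * D := by
      have h1 : (j : ℝ) * (3 * Real.log (k * D)) ≤ j * D := by gcongr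
      have h2 : 3 * Real.log k ≤ D := by simp only [D]; linarith
      linarith
    calc 3 * x * Real.log x = x * (3 * Real.log x) := by ring
      _ ≤ (k * j.factorial * D ^ j) * ((j + 1) * D) := by
        gcongr
      _ = k * (j + 1).factorial * D ^ (j + 1) := by
        rw [Nat.factorial_succ]; push_cast; ring

theorem mul_factorial_mul_pow_lt_pow_self {k : ℕ} (hk : 9 ≤ k) :
    (k : ℝ) * k.factorial * (27 / 16) ^ k < (k : ℝ) ^ k := by
  induction k, hk using Nat.le_induction with
  | base => norm_num [Nat.factorial]
  | succ k hk ih =>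
    have hkR : (9 : ℝ) ≤ k := by exact_mod_cast hk
    have hk0 : (0 : ℝ) < k := by linarith
    have hbern : (27 / 16 : ℝ) ≤ (1 + 1 / k) ^ (k - 1) := by
      refine le_trans ?_ (one_add_mul_le_pow (by linarith [one_div_pos.2 hk0]) (k - 1))
      rw [Nat.cast_sub (by omega)]
      field_simp
      norm_num
      linarith
    have hpow : ((k : ℝ) + 1) ^ (k + 1) =
        (k : ℝ) ^ k * ((k + 1) * ((1 + 1 / k) * (1 + 1 / k) ^ (k - 1))) := by
      rw [← pow_succ', Nat.sub_add_cancel (by omega), show 1 + 1 / (k : ℝ) = (k + 1) / k by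
        field_simp, div_pow]
      field_simp
      ring
    rw [Nat.factorial_succ]
    push_cast
    rw [hpow]
    calc ((k : ℝ) + 1) * ((k + 1) * k.factorial) * (27 / 16) ^ (k + 1)
        = (k * k.factorial * (27 / 16) ^ k) * ((k + 1) * ((1 + 1 / k) * (27 / 16))) := by
          field_simp
          ring
      _ < (k : ℝ) ^ k * ((k + 1) * ((1 + 1 / k) * (27 / 16))) := by gcongr
      _ ≤ _ := by gcongr

theorem iterPrime_upper_bound_of_le (n k : ℕ) (hn : 9 ≤ n) (hnk : n ≤ k) :
    (iterPrime n k : ℝ) < (4 * k * Real.log k) ^ k := by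
  have hk : 9 ≤ k := hn.trans hnk
  have ht := log_ge_of_nine_le (show (9 : ℝ) ≤ k by exact_mod_cast hk)
  calc (iterPrime n k : ℝ) ≤ k * k.factorial * (27 / 4 * Real.log k) ^ k :=
        (iterPrime_le_mul_factorial_mul_pow hn hnk le_rfl).2
    _ = k * k.factorial * (27 / 16) ^ k * (4 * Real.log k) ^ k := by
        rw [mul_assoc _ ((27 / 16 : ℝ) ^ k), ← mul_pow]; ring_nf
    _ < (k : ℝ) ^ k * (4 * Real.log k) ^ k := by
        gcongr
        exact mul_factorial_mul_pow_lt_pow_self hk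
    _ = (4 * k * Real.log k) ^ k := by rw [← mul_pow]; ring_nf
end

section
/- Let L(x) := (x/(x+1))^(x+1) · (log x / log(x+1))^(x+1). Then L(x) > 0.32627 for all real x ≥ 4200. -/
open Real

/-- For `y ≥ 1`, `log y ≤ (y - y⁻¹) / 2`. -/
lemma log_le_half_sub_inv {y : ℝ} (hy : 1 ≤ y) : Real.log y ≤ (y - y⁻¹) / 2 := by
  rw [← Real.sinh_log (by linarith)]
  exact Real.self_le_sinh_iff.2 (Real.log_nonneg hy)

/-- The comparison number is `4199.04 = 2 ^ 4 * 3 ^ 8 / 5 ^ 2`. -/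
lemma lt_log_of_4200_le {x : ℝ} (hx : 4200 ≤ x) : 8.3426 < Real.log x := by
  have h : Real.log (2 ^ 4 * 3 ^ 8 / 5 ^ 2) ≤ Real.log x :=
    Real.log_le_log (by norm_num) (by norm_num; linarith)
  rw [Real.log_div (by norm_num) (by norm_num), Real.log_mul (by norm_num) (by norm_num),
    Real.log_pow, Real.log_pow, Real.log_pow] at h
  push_cast at h
  linarith [Real.log_two_gt_d9, Real.log_three_gt_d9, Real.log_five_lt_d9]

lemma lt_exp_neg_1_12001 : 0.32627 < Real.exp (-1.12001) := by
  have h1 : Real.exp 0.12001 ≤ 1.12751 := by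
    have h := Real.exp_bound' (x := 0.12001) (by norm_num) (by norm_num) (n := 5) (by norm_num)
    norm_num [Finset.sum_range_succ, Nat.factorial] at h ⊢
    linarith
  have h2 : Real.exp 1.12001 < 0.32627⁻¹ := by
    rw [show (1.12001 : ℝ) = 1 + 0.12001 by norm_num, Real.exp_add]
    calc Real.exp 1 * Real.exp 0.12001 ≤ 2.7182818286 * 1.12751 := by
          gcongr
          exact Real.exp_one_lt_d9.le
      _ < _ := by norm_num
  rw [Real.exp_neg]
  exact (lt_inv_comm₀ (Real.exp_pos _) (by norm_num)).1 h2

theorem L_lower_bound (x : ℝ) (hx : 4200 ≤ x) :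
    (x / (x + 1)) ^ (x + 1) * (Real.log x / Real.log (x + 1)) ^ (x + 1) > 0.32627 := by
  have hx0 : 0 < x := by linarith
  have hl := lt_log_of_4200_le hx
  have hl0 : 0 < Real.log x := by linarith
  have hl1 : 0 < Real.log (x + 1) := Real.log_pos (by linarith)
  have hd : (x + 1) * (Real.log (x + 1) - Real.log x) ≤ 1 + 1 / 8400 := by
    rw [← Real.log_div (by positivity) (by positivity)]
    calc (x + 1) * Real.log ((x + 1) / x)
        ≤ (x + 1) * (((x + 1) / x - ((x + 1) / x)⁻¹) / 2) := by
          gcongr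
          exact log_le_half_sub_inv ((one_le_div hx0).2 (by linarith))
      _ = 1 + 1 / (2 * x) := by field_simp; ring
      _ ≤ _ := by gcongr; linarith
  have hll : 1 - Real.log (x + 1) / Real.log x ≤ Real.log (Real.log x / Real.log (x + 1)) := by
    simpa using Real.one_sub_inv_le_log_of_pos (div_pos hl0 hl1)
  have hinv : (Real.log x)⁻¹ ≤ 8.3426⁻¹ := by gcongr
  rw [← Real.mul_rpow (by positivity) (by positivity), Real.rpow_def_of_pos (by positivity),
    Real.log_mul (by positivity) (by positivity), Real.log_div (by positivity) (by positivity)]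
  refine lt_exp_neg_1_12001.trans_le (Real.exp_le_exp.2 ?_)
  have key : (x + 1) * (Real.log (x + 1) - Real.log x) * (1 + (Real.log x)⁻¹) ≤ 1.12001 :=
    calc _ ≤ (1 + 1 / 8400) * (1 + 8.3426⁻¹ : ℝ) := by gcongr
      _ ≤ _ := by norm_num
  calc -1.12001 ≤ -((x + 1) * (Real.log (x + 1) - Real.log x) * (1 + (Real.log x)⁻¹)) :=
        neg_le_neg key
    _ = (Real.log x - Real.log (x + 1) + (1 - Real.log (x + 1) / Real.log x)) * (x + 1) := by
        field_simp
        ring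
    _ ≤ _ := by gcongr
end

section
/- The function h(x) := log(x+1) / (log(x+1) − log x) is strictly increasing for real x ≥ 1. -/
open Real Set

theorem log_add_one_sub_log_lt {x y : ℝ} (hx : 0 < x) (hxy : x < y) :
    Real.log (y + 1) - Real.log y < Real.log (x + 1) - Real.log x := by
  have hy : 0 < y := hx.trans hxy
  rw [← Real.log_div (by positivity) hy.ne', ← Real.log_div (by positivity) hx.ne']
  apply Real.log_lt_log (by positivity)
  rw [div_lt_div_iff₀ hy hx]
  linarith

theorem strictMonoOn_h :
    StrictMonoOn (fun x : ℝ => Real.log (x + 1) / (Real.log (x + 1) - Real.log x))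
      (Set.Ici (1 : ℝ)) := by
  intro x hx y _ hxy
  have hx0 : 0 < x := one_pos.trans_le hx
  have hy0 : 0 < y := hx0.trans hxy
  have hden_pos : 0 < Real.log (y + 1) - Real.log y :=
    sub_pos.2 (Real.log_lt_log hy0 (lt_add_one y))
  have hden := log_add_one_sub_log_lt hx0 hxy
  have hnum : Real.log (x + 1) < Real.log (y + 1) :=
    Real.log_lt_log (by positivity) (by linarith)
  have hnum_pos : 0 < Real.log (x + 1) := Real.log_pos (by linarith)
  change _ / _ < _ / _
  rw [div_lt_div_iff₀ (hden_pos.trans hden) hden_pos]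
  exact mul_lt_mul'' hnum hden hnum_pos.le hden_pos.le
end

section
/- If n is a natural number with n > e^4200, then for all natural numbers k ≥ ⌊log n⌋ the k-fold iterated prime satisfies p_n^(k) > (e · k · log k / log log n)^k. -/
open Real Filter

/-- Weak Stirling upper bound. -/
lemma log_factorial_le_s6 {n : ℕ} (hn : n ≠ 0) :
    log (n.factorial : ℝ) ≤ n * log n - n + log n / 2 + 1 := by
  obtain ⟨m, rfl⟩ := Nat.exists_eq_succ_of_ne_zero hn
  have h1 := Stirling.log_stirlingSeq'_antitone (Nat.zero_le m)
  have hpos : (0 : ℝ) < ((m.succ : ℕ) : ℝ) := by positivity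
  simp only [Function.comp_apply] at h1
  rw [show Nat.succ 0 = 1 from rfl, Stirling.stirlingSeq_one, Stirling.log_stirlingSeq_formula,
    log_div (exp_ne_zero _) (by positivity), log_exp, log_sqrt (by norm_num),
    log_div hpos.ne' (exp_ne_zero _), log_exp, log_mul (by norm_num) hpos.ne'] at h1
  linarith

lemma log_factorial_ge {n : ℕ} (hn : n ≠ 0) :
    n * log n - n ≤ log (n.factorial : ℝ) := by
  have h := Stirling.le_log_factorial_stirling hn
  have h1 : 0 ≤ log (n : ℝ) := log_natCast_nonneg n
  have h2 : 0 ≤ log (2 * π) := log_nonneg (by linarith [pi_gt_three])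
  linarith

lemma le_log_factorial_div {N m : ℕ} (hm : 0 < m) (hN : m ≤ N) :
    (N / m : ℝ) * log (N / m) - N / m - log (N / m) ≤ log ((N / m).factorial : ℝ) := by
  have hM : 0 < N / m := Nat.div_pos hN hm
  have hM' : (0 : ℝ) < ((N / m : ℕ) : ℝ) := by exact_mod_cast hM
  have hm' : (0 : ℝ) < m := by exact_mod_cast hm
  have hx1 : (1 : ℝ) ≤ N / m := by
    rw [le_div_iff₀ hm', one_mul]; exact_mod_cast hN
  have hlt : (N / m : ℝ) < ((N / m : ℕ) : ℝ) + 1 := by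
    rw [div_lt_iff₀ hm']
    have := Nat.lt_mul_div_succ N hm
    rw [mul_comm] at this
    exact_mod_cast this
  set x : ℝ := N / m
  have h1 := log_factorial_ge hM.ne'
  set M : ℝ := ((N / m : ℕ) : ℝ)
  have h2 : log (x / M) ≤ x / M - 1 := log_le_sub_one_of_pos (by positivity)
  rw [log_div (by positivity) (by positivity)] at h2
  have h3 : M * (log x - log M) ≤ x - M := by
    calc M * (log x - log M) ≤ M * (x / M - 1) := by gcongr
      _ = x - M := by field_simp
  nlinarith [log_nonneg hx1]

lemma log_factorial_div_le {N m : ℕ} (hm : 0 < m) (hN : m ≤ N) :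
    log ((N / m).factorial : ℝ) ≤
      (N / m : ℝ) * log (N / m) - N / m + log (N / m) / 2 + 1 := by
  have hM : 0 < N / m := Nat.div_pos hN hm
  have hM' : (1 : ℝ) ≤ ((N / m : ℕ) : ℝ) := by exact_mod_cast hM
  have hle : ((N / m : ℕ) : ℝ) ≤ N / m := Nat.cast_div_le
  have h1 := log_factorial_le_s6 hM.ne'
  set x : ℝ := N / m
  set M : ℝ := ((N / m : ℕ) : ℝ)
  have hx : 0 < x := by linarith
  have h2 : log (M / x) ≤ M / x - 1 := log_le_sub_one_of_pos (by positivity)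
  rw [log_div (by positivity) (by positivity)] at h2
  have h3 : x * (log M - log x) ≤ M - x := by
    calc x * (log M - log x) ≤ x * (M / x - 1) := by gcongr
      _ = M - x := by field_simp
  have h4 : log M ≤ log x := log_le_log (by linarith) hle
  nlinarith [log_nonneg hM']

open ArithmeticFunction hiding log in
lemma log_factorial_div_eq_sum (N m : ℕ) :
    log ((N / m).factorial : ℝ) =
      ∑ d ∈ Finset.Ioc 0 N, vonMangoldt d * ((N / d / m : ℕ) : ℝ) := by
  have h1 : ∀ K : ℕ, log (K.factorial : ℝ) = ∑ d ∈ Finset.Ioc 0 K, log (d : ℝ) := by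
    intro K
    induction K with
    | zero => simp
    | succ K ih =>
      rw [Nat.factorial_succ, Nat.cast_mul, log_mul (by positivity) (by positivity), ih,
        Finset.sum_Ioc_succ_top (Nat.zero_le K), add_comm]
  have h2 := sum_Ioc_mul_zeta_eq_sum vonMangoldt (N / m)
  rw [vonMangoldt_mul_zeta] at h2
  rw [h1]
  simp only [ArithmeticFunction.log_apply] at h2
  rw [h2]
  have hsub : Finset.Ioc 0 (N / m) ⊆ Finset.Ioc 0 N :=
    Finset.Ioc_subset_Ioc_right (Nat.div_le_self N m)
  rw [← Finset.sum_subset hsub]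
  · refine Finset.sum_congr rfl fun d _ ↦ ?_
    rw [Nat.div_div_eq_div_mul, Nat.div_div_eq_div_mul, mul_comm d m]
  · intro d hd hd'
    simp only [Finset.mem_Ioc] at hd hd'
    have : N / m < d := by omega
    rw [Nat.div_div_eq_div_mul, mul_comm d m, ← Nat.div_div_eq_div_mul, Nat.div_eq_of_lt this]
    simp

/-- Chebyshev's inequality, based on the factorial ratio `(30n)! n! / ((15n)! (10n)! (6n)!)`. -/
lemma psi_sub_psi_div_six_le (N : ℕ) :
    Chebyshev.psi N - Chebyshev.psi (N / 6 : ℕ) ≤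
      log (N.factorial : ℝ) + log ((N / 30).factorial : ℝ) - log ((N / 2).factorial : ℝ)
        - log ((N / 3).factorial : ℝ) - log ((N / 5).factorial : ℝ) := by
  have h1 := log_factorial_div_eq_sum N 1
  simp only [Nat.div_one] at h1
  rw [h1, log_factorial_div_eq_sum N 30, log_factorial_div_eq_sum N 2,
    log_factorial_div_eq_sum N 3, log_factorial_div_eq_sum N 5, Chebyshev.psi, Chebyshev.psi,
    Nat.floor_natCast, Nat.floor_natCast,
    ← Finset.sum_sdiff (Finset.Ioc_subset_Ioc_right (Nat.div_le_self N 6) :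
      Finset.Ioc 0 (N / 6) ⊆ Finset.Ioc 0 N), add_sub_cancel_right,
    ← Finset.sum_add_distrib, ← Finset.sum_sub_distrib, ← Finset.sum_sub_distrib,
    ← Finset.sum_sub_distrib]
  have hnn : ∀ q : ℕ, q / 2 + q / 3 + q / 5 ≤ q + q / 30 := by intro q; omega
  have hpos : ∀ q : ℕ, 0 < q → q < 6 → q / 2 + q / 3 + q / 5 + 1 ≤ q + q / 30 := by
    intro q _ _; omega
  have hsub : Finset.Ioc 0 N \ Finset.Ioc 0 (N / 6) ⊆ Finset.Ioc 0 N := Finset.sdiff_subset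
  refine (Finset.sum_le_sum fun d hd ↦ ?_).trans
    (Finset.sum_le_sum_of_subset_of_nonneg hsub fun d _ _ ↦ ?_)
  · simp only [Finset.mem_sdiff, Finset.mem_Ioc] at hd
    have hq0 : 0 < N / d := Nat.div_pos hd.1.2 hd.1.1
    have hq6 : N / d < 6 := by
      rw [Nat.div_lt_iff_lt_mul hd.1.1]
      omega
    have h := hpos _ hq0 hq6
    have h' : ((N / d / 2 : ℕ) : ℝ) + (N / d / 3 : ℕ) + (N / d / 5 : ℕ) + 1
        ≤ (N / d : ℕ) + (N / d / 30 : ℕ) := by exact_mod_cast h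
    nlinarith [ArithmeticFunction.vonMangoldt_nonneg (n := d)]
  · have h' : ((N / d / 2 : ℕ) : ℝ) + (N / d / 3 : ℕ) + (N / d / 5 : ℕ)
        ≤ (N / d : ℕ) + (N / d / 30 : ℕ) := by exact_mod_cast hnn (N / d)
    nlinarith [ArithmeticFunction.vonMangoldt_nonneg (n := d)]

lemma psi_le_psi_div_six_add {N : ℕ} (hN : 30 ≤ N) :
    Chebyshev.psi N ≤ Chebyshev.psi (N / 6 : ℕ) + 0.924 * N + 30 := by
  have h := psi_sub_psi_div_six_le N
  have h1 := log_factorial_le_s6 (n := N) (by omega)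
  have h30 := log_factorial_div_le (N := N) (m := 30) (by norm_num) hN
  have h2 := le_log_factorial_div (N := N) (m := 2) (by norm_num) (by omega)
  have h3 := le_log_factorial_div (N := N) (m := 3) (by norm_num) (by omega)
  have h5 := le_log_factorial_div (N := N) (m := 5) (by norm_num) (by omega)
  have hN0 : (0 : ℝ) < N := by exact_mod_cast (by omega : 0 < N)
  have e30 : log (30 : ℝ) = log 2 + log 3 + log 5 := by
    rw [← log_mul (by norm_num) (by norm_num), ← log_mul (by norm_num) (by norm_num)]; norm_num
  have e2000 : log (2000 : ℝ) = 4 * log 2 + 3 * log 5 := by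
    rw [show (2000 : ℝ) = 2 ^ 4 * 5 ^ 3 by norm_num, log_mul (by norm_num) (by norm_num),
      log_pow, log_pow]
    norm_num
  have hl : log (N / 2000 : ℝ) ≤ N / 2000 - 1 := log_le_sub_one_of_pos (by positivity)
  push_cast at h30 h2 h3 h5
  rw [log_div hN0.ne' (by norm_num)] at h30 h2 h3 h5 hl
  have a2 := log_two_lt_d9
  have a3 := log_three_lt_d9
  have a5 := log_five_lt_d9
  have b2 := log_two_gt_d9
  have b3 := log_three_gt_d9
  have b5 := log_five_gt_d9
  rw [e30] at h30
  rw [e2000] at hl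
  have hcomb : (14 * log 2 + 9 * log 3 + 5 * log 5) / 30 * (N : ℝ) ≤ 0.922 * N := by
    gcongr
    linarith
  nlinarith

lemma psi_le_mul_add (N : ℕ) : Chebyshev.psi N ≤ 1.11 * N + 180000 := by
  induction N using Nat.strong_induction_on with
  | _ N ih =>
    rcases lt_or_ge N 30000 with h | h
    · have h1 := Chebyshev.psi_le_const_mul_self (x := N) (by positivity)
      have h2 : (N : ℝ) ≤ 30000 := by exact_mod_cast h.le
      have h3 : log 4 + 4 ≤ 6 := by rw [log_four_eq]; linarith [log_two_lt_d9]
      nlinarith [Nat.cast_nonneg (α := ℝ) N]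
    · have h1 := psi_le_psi_div_six_add (N := N) (by omega)
      have h2 := ih (N / 6) (by omega)
      have h3 : ((N / 6 : ℕ) : ℝ) ≤ N / 6 := Nat.cast_div_le
      have h4 : (30000 : ℝ) ≤ N := by exact_mod_cast h
      linarith

lemma mul_log_le_theta_nthPrime {n : ℕ} (hn : 0 < n) (y : ℕ) :
    ((n : ℝ) - y) * log (y + 1) ≤ Chebyshev.theta (nthPrime n) := by
  rw [Chebyshev.theta_eq_sum_primesLE_log]
  have hcard : (Nat.primesLE (nthPrime n)).card = n := by
    rw [Nat.primesLE_card_eq_primeCounting, Nat.primeCounting_eq_primeCounting'_succ,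
      Nat.primeCounting', nthPrime, Nat.count_nth_succ_of_infinite Nat.infinite_setOfPred_prime]
    omega
  have hc : n ≤ (Nat.primesLE (nthPrime n) \ Finset.Icc 1 y).card + y := by
    have h := Finset.le_card_sdiff (Finset.Icc 1 y) (Nat.primesLE (nthPrime n))
    rw [hcard, Nat.card_Icc] at h
    omega
  have hc' : (n : ℝ) - y ≤ (Nat.primesLE (nthPrime n) \ Finset.Icc 1 y).card := by
    have : (n : ℝ) ≤ (Nat.primesLE (nthPrime n) \ Finset.Icc 1 y).card + y := by exact_mod_cast hc
    linarith
  have hlog : 0 ≤ log ((y : ℝ) + 1) := log_nonneg (by linarith [Nat.cast_nonneg (α := ℝ) y])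
  calc ((n : ℝ) - y) * log (y + 1)
      ≤ (Nat.primesLE (nthPrime n) \ Finset.Icc 1 y).card * log ((y : ℝ) + 1) := by gcongr
    _ ≤ ∑ p ∈ Nat.primesLE (nthPrime n) \ Finset.Icc 1 y, log (p : ℝ) := by
        rw [← nsmul_eq_mul]
        refine Finset.card_nsmul_le_sum _ _ _ fun p hp ↦ ?_
        simp only [Finset.mem_sdiff, Finset.mem_Icc] at hp
        have h1 := Nat.one_lt_of_mem_primesLE hp.1
        have h2 : y + 1 ≤ p := by omega
        exact log_le_log (by positivity) (by exact_mod_cast h2)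
    _ ≤ ∑ p ∈ Nat.primesLE (nthPrime n), log (p : ℝ) :=
        Finset.sum_le_sum_of_subset_of_nonneg Finset.sdiff_subset
          fun p _ _ ↦ log_natCast_nonneg p

lemma mul_log_le_nthPrime {n : ℕ} (hn : exp 4200 < n) :
    0.898 * (n * log n) ≤ (nthPrime n : ℝ) := by
  have hn0 : (0 : ℝ) < n := (exp_pos _).trans hn
  have hL : 4200 < log (n : ℝ) := (lt_log_iff_exp_lt hn0).2 hn
  have hbig : (1000000 : ℝ) ≤ n := by
    have := quadratic_le_exp_of_nonneg (x := 4200) (by norm_num)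
    linarith
  have h1 := mul_log_le_theta_nthPrime (n := n) (by exact_mod_cast hn0) (n / 1000)
  have h2 := (Chebyshev.theta_le_psi _).trans (psi_le_mul_add (nthPrime n))
  have hy : ((n / 1000 : ℕ) : ℝ) ≤ n / 1000 := Nat.cast_div_le
  have hy' : (n / 1000 : ℝ) ≤ ((n / 1000 : ℕ) : ℝ) + 1 := by
    rw [div_le_iff₀ (by norm_num)]
    have : n ≤ (n / 1000 + 1) * 1000 := by omega
    exact_mod_cast this
  have hlog : log (n : ℝ) - 6.91 ≤ log (((n / 1000 : ℕ) : ℝ) + 1) := by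
    have h3 := log_le_log (by positivity) hy'
    rw [log_div hn0.ne' (by norm_num), show (1000 : ℝ) = 10 ^ 3 by norm_num, log_pow,
      log_ten_eq] at h3
    push_cast at h3
    linarith [log_two_lt_d9, log_five_lt_d9]
  have h3 : 0.999 * (n : ℝ) * (0.9983 * log n) ≤ (n - (n / 1000 : ℕ)) * log ((n / 1000 : ℕ) + 1) := by
    gcongr
    · linarith
    · linarith
    · linarith
  nlinarith

lemma log_nthPrime_ge {n : ℕ} (hn : exp 4200 < n) :
    log n + log (log n) - 0.111 ≤ log (nthPrime n : ℝ) := by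
  have hn0 : (0 : ℝ) < n := (exp_pos _).trans hn
  have hL : 4200 < log (n : ℝ) := (lt_log_iff_exp_lt hn0).2 hn
  have h := log_le_log (by positivity) (mul_log_le_nthPrime hn)
  rw [log_mul (by norm_num) (by positivity), log_mul hn0.ne' (by positivity)] at h
  have h1 : -0.111 ≤ log (0.898 : ℝ) := by
    rw [neg_le, ← log_inv, log_le_iff_le_exp (by norm_num)]
    have := quadratic_le_exp_of_nonneg (x := 0.111) (by norm_num)
    norm_num at this ⊢
    linarith
  linarith

lemma log_4200_gt : 8.34 < log 4200 := by
  rw [lt_log_iff_exp_lt (by norm_num), show (8.34 : ℝ) = (8 : ℕ) * 1 + 0.34 by norm_num, exp_add,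
    exp_nat_mul]
  have h1 : exp 1 ^ 8 ≤ 2.7182818286 ^ 8 := by gcongr; exact exp_one_lt_d9.le
  have h2 := exp_bound' (x := 0.34) (by norm_num) (by norm_num) (n := 6) (by norm_num)
  norm_num [Finset.sum_range_succ, Nat.factorial] at h2
  calc exp 1 ^ 8 * exp 0.34 ≤ 2.7182818286 ^ 8 * 1.40496 := by
        gcongr
        norm_num
        linarith
    _ < 4200 := by norm_num

lemma log_log_4200_gt : 2.1205 < log (8.34 : ℝ) := by
  rw [lt_log_iff_exp_lt (by norm_num), show (2.1205 : ℝ) = (2 : ℕ) * 1 + 0.1205 by norm_num,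
    exp_add, exp_nat_mul]
  have h1 : exp 1 ^ 2 ≤ 2.7182818286 ^ 2 := by gcongr; exact exp_one_lt_d9.le
  have h2 := exp_bound' (x := 0.1205) (by norm_num) (by norm_num) (n := 5) (by norm_num)
  norm_num [Finset.sum_range_succ, Nat.factorial] at h2
  calc exp 1 ^ 2 * exp 0.1205 ≤ 2.7182818286 ^ 2 * 1.12807 := by
        gcongr
        norm_num
        linarith
    _ < 8.34 := by norm_num

/-- The first `⌊L⌋` steps of a recursion `l (j + 1) ≥ l j + log (l j) - 0.111` from `L`. -/
lemma recursion_initial {L : ℝ} (hL : 4200 < L) {l : ℕ → ℝ} (h0 : l 0 = L)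
    (hs : ∀ j, L ≤ l j → l j + log (l j) - 0.111 ≤ l (j + 1)) (j : ℕ) (hj : (j : ℝ) ≤ L) :
    L + j * (log L - 0.111) + 0.4 * j * (j - 1) / L ≤ l j := by
  have hL0 : 0 < L := by linarith
  have hu : 8.34 < log L := log_4200_gt.trans (log_lt_log (by norm_num) hL)
  induction j with
  | zero => simp [h0]
  | succ j ih =>
    push_cast at hj ⊢
    have h1 := ih (by linarith)
    have hj0 : (0 : ℝ) ≤ j := Nat.cast_nonneg j
    have hq : -0.1 * (j : ℝ) ≤ 0.4 * j * (j - 1) / L := by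
      rw [le_div_iff₀ hL0]
      nlinarith
    have hlow : L + 8 * j ≤ l j := by nlinarith
    have h2 := hs j (by linarith)
    have h3 : log (L + 8 * j) ≤ log (l j) := log_le_log (by positivity) hlow
    have h4 : log (L / (L + 8 * j)) ≤ L / (L + 8 * j) - 1 :=
      log_le_sub_one_of_pos (by positivity)
    rw [log_div hL0.ne' (by positivity)] at h4
    have h5 : L / (L + 8 * j) - 1 ≤ - (0.8 * j / L) := by
      rw [sub_le_iff_le_add, div_le_iff₀ (by positivity)]
      have : (-(0.8 * j / L) + 1) * (L + 8 * j) = L + 7.2 * j - 6.4 * j * (j / L) := by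
        field_simp
        ring
      rw [this]
      have h6 : j / L ≤ 1 := by rw [div_le_one hL0]; linarith
      nlinarith
    have h6 : 0.4 * ((j : ℝ) + 1) * (j + 1 - 1) / L = 0.4 * j * (j - 1) / L + 0.8 * j / L := by
      ring
    rw [h6]
    linarith

lemma add_one_mul_log_le {x : ℝ} (c : ℝ) (hx : 3 ≤ x) :
    (x + 1) * (1 + log (x + 1) + log (log (x + 1)) - c) ≤
      x * (1 + log x + log (log x) - c) +
        (2 + log x + log (log x) - c + 1 / log x + 1 / x + 1 / (x * log x)) := by
  have hx0 : 0 < x := by linarith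
  have hv : 0 < log x := log_pos (by linarith)
  have h1 : log (x + 1) ≤ log x + 1 / x := by
    have h := log_le_sub_one_of_pos (x := (x + 1) / x) (by positivity)
    rw [log_div (by positivity) hx0.ne', add_div, div_self hx0.ne'] at h
    linarith
  have hv1 : 0 < log (x + 1) := log_pos (by linarith)
  have h2 : log (log (x + 1)) ≤ log (log x) + 1 / (x * log x) := by
    have h := log_le_sub_one_of_pos (x := log (x + 1) / log x) (by positivity)
    rw [log_div hv1.ne' hv.ne'] at h
    have h' : log (x + 1) / log x ≤ (log x + 1 / x) / log x := by gcongr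
    have h'' : (log x + 1 / x) / log x = 1 + 1 / (x * log x) := by field_simp
    linarith
  have e1 : (x + 1) * (1 / x) = 1 + 1 / x := by field_simp
  have e2 : (x + 1) * (1 / (x * log x)) = 1 / log x + 1 / (x * log x) := by field_simp
  nlinarith

lemma add_log_sub_log_le {u v : ℝ} (hu : 8.34 < u) (hv : 8.34 ≤ v) (huv : u - 0.001 ≤ v) :
    2.1113 + (log v - log u) + 1 / v ≤ log (1 + v + log v - log u) := by
  have hv0 : 0 < v := by linarith
  have hu0 : 0 < u := by linarith
  have hlam : 2.1205 < log u := log_log_4200_gt.trans (log_lt_log (by norm_num) hu)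
  have hw : -0.0002 ≤ log v - log u := by
    have h := log_le_sub_one_of_pos (x := u / v) (by positivity)
    rw [log_div hu0.ne' hv0.ne'] at h
    have h' : u / v ≤ 1.0002 := by rw [div_le_iff₀ hv0]; linarith
    linarith
  set w := log v - log u with hw_def
  have hz : 0 ≤ (1 + w) / v := div_nonneg (by linarith) hv0.le
  have h1 := le_log_one_add_of_nonneg hz
  have e1 : log (1 + v + log v - log u) = log v + log (1 + (1 + w) / v) := by
    rw [← log_mul hv0.ne' (by linarith)]
    congr 1
    rw [mul_add, mul_div_cancel₀ _ hv0.ne']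
    rw [hw_def]
    ring
  have hden : 0 < v * (1 + w + 2 * v) := mul_pos hv0 (by linarith)
  have e2 : 2 * ((1 + w) / v) / ((1 + w) / v + 2) - 1 / v =
      (2 * v * w - 1 - w) / (v * (1 + w + 2 * v)) := by
    have : 1 + w + 2 * v ≠ 0 := by linarith
    have : (1 + w) / v + 2 ≠ 0 := by linarith
    field_simp
    ring
  have h2 : -0.009 ≤ (2 * v * w - 1 - w) / (v * (1 + w + 2 * v)) := by
    rw [le_div_iff₀ hden]
    nlinarith
  rw [e1]
  linarith

/-- Any sequence with `l (j + 1) ≥ l j + log (l j) - 0.111` started at `L > 4200` dominates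
`k (1 + log k + log log k - log log L)` for `k ≥ ⌊L⌋`. -/
lemma recursion_lower_bound {L : ℝ} (hL : 4200 < L) {l : ℕ → ℝ} (h0 : l 0 = L)
    (hs : ∀ j, L ≤ l j → l j + log (l j) - 0.111 ≤ l (j + 1)) (hmono : ∀ j, L ≤ l j)
    (k : ℕ) (hk : ⌊L⌋₊ ≤ k) :
    k * (1 + log k + log (log k) - log (log L)) < l k := by
  have hL0 : 0 < L := by linarith
  have hu : 8.34 < log L := log_4200_gt.trans (log_lt_log (by norm_num) hL)
  induction k, hk using Nat.le_induction with
  | base =>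
    have hkL : ((⌊L⌋₊ : ℕ) : ℝ) ≤ L := Nat.floor_le hL0.le
    have hLk : L < (⌊L⌋₊ : ℕ) + 1 := Nat.lt_floor_add_one L
    have h := recursion_initial hL h0 hs _ hkL
    set x : ℝ := ((⌊L⌋₊ : ℕ) : ℝ)
    have hx0 : 0 < x := by linarith
    have hlog : log x ≤ log L := log_le_log hx0 hkL
    have hloglog : log (log x) ≤ log (log L) := log_le_log (log_pos (by linarith)) hlog
    have h1 : 0.3 * x ≤ 0.4 * x * (x - 1) / L := by
      rw [le_div_iff₀ hL0]
      nlinarith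
    nlinarith
  | succ k hk ih =>
    have hLk : L < (k : ℝ) + 1 := (Nat.lt_floor_add_one L).trans_le (by gcongr)
    have hk' : 4200 ≤ k := (Nat.le_floor (by exact_mod_cast hL.le)).trans hk
    have hkr : (4200 : ℝ) ≤ k := by exact_mod_cast hk'
    set x : ℝ := (k : ℝ)
    have hx0 : 0 < x := by linarith
    have hv : 8.34 ≤ log x := log_4200_gt.le.trans (log_le_log (by norm_num) hkr)
    have hv0 : 0 < log x := by linarith
    have hx1 : 1 / x ≤ 1 / 4200 := by gcongr
    have huv : log L - 0.001 ≤ log x := by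
      have h := log_le_sub_one_of_pos (x := L / x) (by positivity)
      rw [log_div hL0.ne' hx0.ne'] at h
      have h' : L / x ≤ 1 + 1 / x := by
        rw [div_le_iff₀ hx0, add_mul, one_div_mul_cancel hx0.ne']
        linarith
      linarith
    have h1 := add_log_sub_log_le hu hv huv
    have h2 := add_one_mul_log_le (log (log L)) (x := x) (by linarith)
    have h3 := hs k (hmono k)
    have hx2 : 1 / (x * log x) ≤ 1 / (4200 * 8.34) := by gcongr
    have hpos : 0 < 1 + log x + log (log x) - log (log L) := by
      by_contra! hneg
      have h4 : 0 < 1 / log x := by positivity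
      have h5 : log (log L) ≤ log (2 * log x) := log_le_log (by linarith) (by linarith)
      rw [log_mul (by norm_num) hv0.ne'] at h5
      linarith [log_two_lt_d9]
    have h4 := log_lt_log (by positivity) ih
    rw [log_mul hx0.ne' hpos.ne'] at h4
    push_cast
    norm_num at hx1 hx2 h1 h2 h3 ⊢
    linarith

lemma log_le_log_iterPrime_and_exp_lt {n : ℕ} (hn : exp 4200 < n) (k : ℕ) :
    log n ≤ log (iterPrime n k : ℝ) ∧ exp 4200 < (iterPrime n k : ℝ) := by
  induction k with
  | zero => exact ⟨le_rfl, hn⟩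
  | succ k ih =>
    obtain ⟨h1, h2⟩ := ih
    have h3 := log_nthPrime_ge h2
    have hn0 : (0 : ℝ) < n := (exp_pos _).trans hn
    have hL : 4200 < log (n : ℝ) := (lt_log_iff_exp_lt hn0).2 hn
    have h4 := log_4200_gt.trans (log_lt_log (by norm_num) (hL.trans_le h1))
    have h5 : log n ≤ log (iterPrime n (k + 1) : ℝ) := by
      rw [iterPrime]
      linarith
    have h6 : (0 : ℝ) < (iterPrime n (k + 1) : ℝ) := by
      rw [iterPrime, nthPrime]
      exact_mod_cast (Nat.prime_nth_prime _).pos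
    exact ⟨h5, (lt_log_iff_exp_lt h6).1 (hL.trans_le h5)⟩

theorem iterPrime_lower_bound (n : ℕ) (hn : (n : ℝ) > Real.exp 4200)
    (k : ℕ) (hk : ⌊Real.log n⌋₊ ≤ k) :
    (iterPrime n k : ℝ) >
      (Real.exp 1 * k * Real.log k / Real.log (Real.log n)) ^ k := by
  have hn0 : (0 : ℝ) < n := (exp_pos _).trans hn
  have hL : 4200 < log (n : ℝ) := (lt_log_iff_exp_lt hn0).2 hn
  have hu : 0 < log (log (n : ℝ)) := log_pos (by linarith)
  have hk' : 4200 ≤ k := (Nat.le_floor (by exact_mod_cast hL.le)).trans hk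
  have hk0 : (0 : ℝ) < k := by exact_mod_cast (by omega : 0 < k)
  have hv : 0 < log (k : ℝ) := log_pos (by exact_mod_cast (by omega : 1 < k))
  have h := recursion_lower_bound hL (l := fun j ↦ log (iterPrime n j : ℝ)) rfl
    (fun j _ ↦ log_nthPrime_ge (log_le_log_iterPrime_and_exp_lt hn j).2)
    (fun j ↦ (log_le_log_iterPrime_and_exp_lt hn j).1) k hk
  have hpos : (0 : ℝ) < iterPrime n k := (exp_pos _).trans (log_le_log_iterPrime_and_exp_lt hn k).2
  rw [gt_iff_lt, ← log_lt_log_iff (by positivity) hpos, log_pow,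
    log_div (by positivity) hu.ne', log_mul (by positivity) hv.ne',
    log_mul (exp_ne_zero _) hk0.ne', log_exp]
  exact h
end

section
/- For every natural number n ≥ 1, there do not exist real constants c > 0 and β such that exp(P_n^T(x)) ∼ c · x · (log x)^β as x → ∞ (i.e., such that exp(P_n^T(x)) / (c·x·(log x)^β) tends to 1 as x → ∞). -/
open Real Filter

/-- The counting function `P_n^T(x) = #{k ≥ 1 : p_n^(k) ≤ x}`. -/
noncomputable def PnT (n : ℕ) (x : ℝ) : ℕ :=
  {k : ℕ | 1 ≤ k ∧ (iterPrime n k : ℝ) ≤ x}.ncard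

/-- The counting function `DiagP(x) = #{k ≥ 1 : p_k^(k) ≤ x}`. -/
noncomputable def DiagP (x : ℝ) : ℕ :=
  {k : ℕ | 1 ≤ k ∧ (iterPrime k k : ℝ) ≤ x}.ncard

theorem lt_nthPrime_s13 {m : ℕ} (hm : 1 ≤ m) : m < nthPrime m := by
  have h := Nat.add_two_le_nth_prime (m - 1)
  unfold nthPrime
  omega

theorem one_le_iterPrime {n : ℕ} (hn : 1 ≤ n) (k : ℕ) : 1 ≤ iterPrime n k := by
  induction k with
  | zero => exact hn
  | succ k ih => exact ih.trans (lt_nthPrime_s13 ih).le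

theorem iterPrime_strictMono {n : ℕ} (hn : 1 ≤ n) : StrictMono (iterPrime n) :=
  strictMono_nat_of_lt_succ fun k => lt_nthPrime_s13 (one_le_iterPrime hn k)

theorem PnT_eq_of_mem_Ico {n : ℕ} (hn : 1 ≤ n) {k : ℕ} {x : ℝ}
    (hx : x ∈ Set.Ico (iterPrime n k : ℝ) (iterPrime n (k + 1))) : PnT n x = k := by
  have hset : {j : ℕ | 1 ≤ j ∧ (iterPrime n j : ℝ) ≤ x} = Finset.Icc 1 k := by
    ext j
    simp only [Set.mem_ofPred_eq, Finset.coe_Icc, Set.mem_Icc, and_congr_right_iff]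
    intro _
    constructor
    · intro hj
      have hlt : iterPrime n j < iterPrime n (k + 1) := by exact_mod_cast hj.trans_lt hx.2
      exact Nat.lt_succ_iff.mp ((iterPrime_strictMono hn).lt_iff_lt.mp hlt)
    · intro hj
      exact le_trans (by exact_mod_cast (iterPrime_strictMono hn).monotone hj) hx.1
  rw [PnT, hset, Set.ncard_coe_finset, Nat.card_Icc, Nat.add_sub_cancel]

theorem not_exists_exp_PnT_asymp (n : ℕ) (hn : 1 ≤ n) :
    ¬ ∃ (c : ℝ), c > 0 ∧ ∃ (β : ℝ),
      Filter.Tendsto (fun x : ℝ => Real.exp (PnT n x) / (c * x * (Real.log x) ^ β))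
        Filter.atTop (nhds 1) := by
  rintro ⟨c, hc, β, h⟩
  obtain ⟨X, hX⟩ := eventually_atTop.mp
    (h.eventually (Ioo_mem_nhds (show (0.9 : ℝ) < 1 by norm_num) (show (1 : ℝ) < 1.1 by norm_num)))
  obtain ⟨k, hk⟩ := exists_nat_gt (max X 2)
  have hmono := iterPrime_strictMono hn
  have hka : (k : ℝ) ≤ iterPrime n k := by exact_mod_cast hmono.id_le k
  have hab : (iterPrime n k : ℝ) < iterPrime n (k + 1) := by exact_mod_cast hmono k.lt_succ_self
  have hbc : (iterPrime n (k + 1) : ℝ) < iterPrime n (k + 2) := by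
    exact_mod_cast hmono (k + 1).lt_succ_self
  set a := (iterPrime n k : ℝ)
  set b := (iterPrime n (k + 1) : ℝ)
  have hXa : X < a := (le_max_left X 2).trans_lt (hk.trans_le hka)
  have h2a : 2 < a := (le_max_right X 2).trans_lt (hk.trans_le hka)
  have hlog : 0 < Real.log b := Real.log_pos (by linarith)
  have hgpos : 0 < c * b * Real.log b ^ β := by
    have : 0 < b := by linarith
    positivity
  have hcont : ContinuousAt (fun x : ℝ => Real.exp k / (c * x * Real.log x ^ β)) b := by
    refine continuousAt_const.div ((continuousAt_const.mul continuousAt_id).mul ?_) hgpos.ne'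
    exact (Real.continuousAt_log (by linarith)).rpow_const (Or.inl hlog.ne')
  have hleft : 0.9 ≤ Real.exp k / (c * b * Real.log b ^ β) := by
    refine ge_of_tendsto (hcont.tendsto.mono_left (nhdsWithin_le_nhds (s := Set.Iio b))) ?_
    filter_upwards [Ico_mem_nhdsLT hab] with y hy
    have hy' := (hX y (hXa.le.trans hy.1)).1
    rw [PnT_eq_of_mem_Ico hn hy] at hy'
    exact hy'.le
  have hright := (hX b (hXa.trans hab).le).2
  rw [PnT_eq_of_mem_Ico hn ⟨le_rfl, hbc⟩, Nat.cast_succ, Real.exp_add, mul_comm, mul_div_assoc]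
    at hright
  nlinarith [Real.add_one_le_exp (1 : ℝ)]
end
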